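/- Fix α₀, α₁ > 0, n ∈ ℕ, and let τ_n := inf{t ∈ ℕ : S_{0,t} ≥ α₀ n or S_{1,t} ≥ α₁ n}, and c₀ := max_{x∈𝒳} |log(p₀*(x)/q₀*(x))|, c₁ := max_{x∈𝒳} |log(q₁*(x)/p₁*(x))|. Then for every adaptive adversary strategy for H₀ (law ℙ), E_ℙ[τ_n] ≤ (α₀ n + c₀)/D(p₀*‖q₀*); and for every adaptive adversary strategy for H₁ (law ℚ), E_ℚ[τ_n] ≤ (α₁ n + c₁)/D(q₁*‖p₁*). -/

import Mathlib

open scoped BigOperators ENNReal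

variable {𝒳 : Type*}

/-- A probability mass function on the finite alphabet `𝒳`. -/
def IsDist [Fintype 𝒳] (f : 𝒳 → ℝ) : Prop :=
  (∀ x, 0 ≤ f x) ∧ ∑ x, f x = 1

/-- Kullback–Leibler divergence `D(p‖q) = ∑ₓ p(x) log (p(x)/q(x))`. -/
noncomputable def KL [Fintype 𝒳] (p q : 𝒳 → ℝ) : ℝ :=
  ∑ x, p x * Real.log (p x / q x)

/-- Probability of observing the finite sequence `l` under the adaptive strategy `str`:
`ℙ(x^t) = ∏ᵢ str(x^{i-1})(xᵢ)`. -/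
noncomputable def seqProb [Fintype 𝒳] (str : List 𝒳 → 𝒳 → ℝ) (l : List 𝒳) : ℝ :=
  ∏ i : Fin l.length, str (l.take i.1) (l.get i)

/-- Log-likelihood-ratio sum `S_t = ∑ᵢ log (p(xᵢ)/q(xᵢ))`. -/
noncomputable def llSum (p q : 𝒳 → ℝ) (l : List 𝒳) : ℝ :=
  ∑ i : Fin l.length, Real.log (p (l.get i) / q (l.get i))

/-- An adaptive adversary strategy choosing, after each history, a distribution in `P`. -/
def IsStrategy (P : Set (𝒳 → ℝ)) (str : List 𝒳 → 𝒳 → ℝ) : Prop :=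
  ∀ l, str l ∈ P

open Classical in
/-- Probability that the first `n` observations form a sequence satisfying `E`. -/
noncomputable def probAt [Fintype 𝒳] (str : List 𝒳 → 𝒳 → ℝ) (n : ℕ)
    (E : List 𝒳 → Prop) : ℝ :=
  ∑ x : Fin n → 𝒳, if E (List.ofFn x) then seqProb str (List.ofFn x) else 0

/-- No prefix of `l` (including `l` itself) lies in the stopping region `B`;
for `l` of length `n` this is the event `{τ_B > n}`. -/
def notYet (B : List 𝒳 → Prop) (l : List 𝒳) : Prop :=
  ∀ t ≤ l.length, ¬ B (l.take t)

/-- `l` is a stopped sequence of the first-hitting time `τ_B` of the region `B`. -/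
def stopsAt (B : List 𝒳 → Prop) (l : List 𝒳) : Prop :=
  B l ∧ ∀ t < l.length, ¬ B (l.take t)

/-- Expected stopping time `E[τ_B] = ∑_{n ≥ 0} ℙ(τ_B > n)`, valued in `ℝ≥0∞`. -/
noncomputable def expTau [Fintype 𝒳] (str : List 𝒳 → 𝒳 → ℝ) (B : List 𝒳 → Prop) : ℝ≥0∞ :=
  ∑' n : ℕ, ENNReal.ofReal (probAt str n (notYet B))

open Classical in
/-- Expectation of `f` evaluated at the stopped sequence `X^{τ_B}`. -/
noncomputable def expStopped [Fintype 𝒳] (str : List 𝒳 → 𝒳 → ℝ) (B : List 𝒳 → Prop)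
    (f : List 𝒳 → ℝ) : ℝ :=
  ∑' l : List 𝒳, if stopsAt B l then seqProb str l * f l else 0

open Classical in
/-- Probability that the process stops (via `B`) at a sequence satisfying `E`. -/
noncomputable def probStopIn [Fintype 𝒳] (str : List 𝒳 → 𝒳 → ℝ) (B : List 𝒳 → Prop)
    (E : List 𝒳 → Prop) : ℝ :=
  ∑' l : List 𝒳, if stopsAt B l ∧ E l then seqProb str l else 0

/-- Gibbs' inequality, strict form, for distinct distributions with common support. -/
theorem KL_pos [Fintype 𝒳] {p q : 𝒳 → ℝ} (hp : IsDist p) (hq : IsDist q)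
    (hpq : ∀ x, p x = 0 ↔ q x = 0) (hne : p ≠ q) : 0 < KL p q := by
  have key : ∀ x, p x ≠ q x → p x - q x < p x * Real.log (p x / q x) := by
    intro x hx
    have hp0 : p x ≠ 0 := fun h => hx (by rw [h, (hpq x).1 h])
    have hq0 : q x ≠ 0 := fun h => hp0 ((hpq x).2 h)
    have hppos : 0 < p x := lt_of_le_of_ne (hp.1 x) hp0.symm
    have hqpos : 0 < q x := lt_of_le_of_ne (hq.1 x) hq0.symm
    have hlog : Real.log (q x / p x) < q x / p x - 1 :=
      Real.log_lt_sub_one_of_pos (by positivity) fun h => hx ((div_eq_one_iff_eq hp0).1 h).symm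
    rw [← inv_div (q x) (p x), Real.log_inv]
    have h := mul_lt_mul_of_pos_left hlog hppos
    have e : p x * (q x / p x - 1) = q x - p x := by field_simp
    linarith
  obtain ⟨x₀, hx₀⟩ := Function.ne_iff.1 hne
  have hlt : ∑ x, (p x - q x) < ∑ x, p x * Real.log (p x / q x) := by
    refine Finset.sum_lt_sum (fun x _ => ?_) ⟨x₀, Finset.mem_univ _, key x₀ hx₀⟩
    by_cases h : p x = q x
    · rw [h]
      by_cases h0 : q x = 0 <;> simp [h0]
    · exact (key x h).le
  rw [Finset.sum_sub_distrib, hp.2, hq.2, sub_self] at hlt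
  exact hlt

/-- First-order optimality of a minimiser of `p ↦ D(p‖q)` on a convex set of distributions with
common support. -/
theorem KL_le_sum_mul_log_of_isMin [Fintype 𝒳] {P : Set (𝒳 → ℝ)} (hP : ∀ p ∈ P, IsDist p)
    (hconv : Convex ℝ P) {p₀ q₀ : 𝒳 → ℝ} (hp₀ : p₀ ∈ P)
    (hac : ∀ p ∈ P, ∀ x, (p x = 0 ↔ q₀ x = 0)) (hmin : ∀ p ∈ P, KL p₀ q₀ ≤ KL p q₀)
    {p : 𝒳 → ℝ} (hp : p ∈ P) : KL p₀ q₀ ≤ ∑ x, p x * Real.log (p₀ x / q₀ x) := by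
  set A := ∑ x, p x * Real.log (p₀ x / q₀ x) with hA
  set C := ∑ x, (p x - p₀ x) ^ 2 / p₀ x with hC
  have step : ∀ t : ℝ, 0 < t → t ≤ 1 → KL p₀ q₀ ≤ A + t * C := by
    intro t ht ht1
    set r : 𝒳 → ℝ := fun x => (1 - t) * p₀ x + t * p x with hr
    have hrP : r ∈ P := hconv hp₀ hp (by linarith) ht.le (by ring)
    have hbound : KL r q₀ ≤ ∑ x, ((1 - t) * (p₀ x * Real.log (p₀ x / q₀ x))
        + t * (p x * Real.log (p₀ x / q₀ x))
        + (t ^ 2 * ((p x - p₀ x) ^ 2 / p₀ x) + t * (p x - p₀ x))) := by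
      refine Finset.sum_le_sum fun x _ => ?_
      by_cases h0 : q₀ x = 0
      · simp [(hac r hrP x).2 h0, (hac p hp x).2 h0, (hac p₀ hp₀ x).2 h0]
      have hr0 : r x ≠ 0 := fun h => h0 ((hac r hrP x).1 h)
      have hp0 : p₀ x ≠ 0 := fun h => h0 ((hac p₀ hp₀ x).1 h)
      have hrpos : 0 < r x := lt_of_le_of_ne ((hP r hrP).1 x) hr0.symm
      have hppos : 0 < p₀ x := lt_of_le_of_ne ((hP p₀ hp₀).1 x) hp0.symm
      have hsplit : Real.log (r x / q₀ x)
          = Real.log (r x / p₀ x) + Real.log (p₀ x / q₀ x) := by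
        rw [← Real.log_mul (div_ne_zero hr0 hp0) (div_ne_zero hp0 h0), div_mul_div_cancel₀ hp0]
      have hlog := mul_le_mul_of_nonneg_left
        (Real.log_le_sub_one_of_pos (div_pos hrpos hppos)) hrpos.le
      have e : r x * (r x / p₀ x - 1)
          = t ^ 2 * ((p x - p₀ x) ^ 2 / p₀ x) + t * (p x - p₀ x) := by
        simp only [hr]
        field_simp
        ring
      have e' : r x * Real.log (p₀ x / q₀ x) = (1 - t) * (p₀ x * Real.log (p₀ x / q₀ x))
          + t * (p x * Real.log (p₀ x / q₀ x)) := by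
        simp only [hr]
        ring
      rw [hsplit, mul_add]
      linarith
    simp only [Finset.sum_add_distrib, ← Finset.mul_sum, Finset.sum_sub_distrib, (hP p hp).2,
      (hP p₀ hp₀).2, sub_self, mul_zero, add_zero] at hbound
    have hm := (hmin r hrP).trans hbound
    change KL p₀ q₀ ≤ (1 - t) * KL p₀ q₀ + t * A + t ^ 2 * C at hm
    have : t * KL p₀ q₀ ≤ t * (A + t * C) := by linarith
    exact le_of_mul_le_mul_left this ht
  have hlim : Filter.Tendsto (fun t : ℝ => A + t * C) (nhdsWithin 0 (Set.Ioi 0)) (nhds A) := by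
    have h : Continuous fun t : ℝ => A + t * C := by fun_prop
    have h' := h.tendsto 0
    simp only [zero_mul, add_zero] at h'
    exact h'.mono_left nhdsWithin_le_nhds
  refine ge_of_tendsto hlim ?_
  filter_upwards [Ioc_mem_nhdsGT (zero_lt_one (α := ℝ))] with t ht
  exact step t ht.1 ht.2

theorem seqProb_nonneg [Fintype 𝒳] {str : List 𝒳 → 𝒳 → ℝ} (hstr : ∀ l x, 0 ≤ str l x)
    (l : List 𝒳) : 0 ≤ seqProb str l :=
  Finset.prod_nonneg fun _ _ => hstr _ _

theorem seqProb_append_singleton [Fintype 𝒳] (str : List 𝒳 → 𝒳 → ℝ) (l : List 𝒳) (x : 𝒳) :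
    seqProb str (l ++ [x]) = seqProb str l * str l x := by
  have h : l.length + 1 = (l ++ [x]).length := by simp
  unfold seqProb
  rw [← Fin.prod_congr' _ h, Fin.prod_univ_castSucc]
  congr 1
  · refine Finset.prod_congr rfl fun i _ => ?_
    simp [List.take_append_of_le_length i.2.le]
  · simp

theorem llSum_append_singleton (p q : 𝒳 → ℝ) (l : List 𝒳) (x : 𝒳) :
    llSum p q (l ++ [x]) = llSum p q l + Real.log (p x / q x) := by
  have h : l.length + 1 = (l ++ [x]).length := by simp
  unfold llSum
  rw [← Fin.sum_congr' _ h, Fin.sum_univ_castSucc]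
  congr 1
  · refine Finset.sum_congr rfl fun i _ => ?_
    simp
  · simp

theorem notYet.not_self {B : List 𝒳 → Prop} {l : List 𝒳} (h : notYet B l) : ¬ B l := by
  simpa using h l.length le_rfl

theorem notYet.of_append_singleton {B : List 𝒳 → Prop} {l : List 𝒳} {x : 𝒳}
    (h : notYet B (l ++ [x])) : notYet B l := by
  intro t ht
  have := h t (by simp; omega)
  rwa [List.take_append_of_le_length ht] at this

theorem sum_ofFn_succ [Fintype 𝒳] (n : ℕ) (f : List 𝒳 → ℝ) :
    ∑ x : Fin (n + 1) → 𝒳, f (List.ofFn x)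
      = ∑ y : Fin n → 𝒳, ∑ x : 𝒳, f (List.ofFn y ++ [x]) := by
  rw [← (Fin.snocEquiv fun _ : Fin (n + 1) => 𝒳).sum_comp, Fintype.sum_prod_type_right]
  refine Finset.sum_congr rfl fun y _ => Finset.sum_congr rfl fun x _ => ?_
  rw [List.ofFn_succ']
  simp [Fin.snocEquiv, List.concat_eq_append]

open Classical in
/-- Expected distance of the log-likelihood-ratio sum from the level `b` at time `n`, on the event
that the process has not stopped. -/
noncomputable def expGap [Fintype 𝒳] (str : List 𝒳 → 𝒳 → ℝ) (B : List 𝒳 → Prop)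
    (p q : 𝒳 → ℝ) (b : ℝ) (n : ℕ) : ℝ :=
  ∑ x : Fin n → 𝒳, if notYet B (List.ofFn x) then
    seqProb str (List.ofFn x) * (b - llSum p q (List.ofFn x)) else 0

section drift

variable [Fintype 𝒳] {str : List 𝒳 → 𝒳 → ℝ} {B : List 𝒳 → Prop} {p q : 𝒳 → ℝ} {a c D : ℝ}

theorem expGap_nonneg (hstr : ∀ l, IsDist (str l)) (hc : 0 ≤ c)
    (hB : ∀ l, ¬ B l → llSum p q l < a) (n : ℕ) : 0 ≤ expGap str B p q (a + c) n := by
  refine Finset.sum_nonneg fun y _ => ?_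
  split_ifs with h
  · have := hB _ h.not_self
    exact mul_nonneg (seqProb_nonneg (fun l => (hstr l).1) _) (by linarith)
  · exact le_rfl

theorem expGap_succ_le (hstr : ∀ l, IsDist (str l))
    (hc : ∀ x, |Real.log (p x / q x)| ≤ c)
    (hdrift : ∀ l, D ≤ ∑ x, str l x * Real.log (p x / q x))
    (hB : ∀ l, ¬ B l → llSum p q l < a) (n : ℕ) :
    D * probAt str n (notYet B) + expGap str B p q (a + c) (n + 1)
      ≤ expGap str B p q (a + c) n := by
  classical
  unfold expGap probAt
  rw [sum_ofFn_succ n fun l => if notYet B l then seqProb str l * (a + c - llSum p q l) else 0,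
    Finset.mul_sum, ← Finset.sum_add_distrib]
  refine Finset.sum_le_sum fun y _ => ?_
  set l := List.ofFn y
  by_cases hl : notYet B l
  · have hs := seqProb_nonneg (fun l => (hstr l).1) l
    have hle : ∑ x, (if notYet B (l ++ [x]) then
        seqProb str (l ++ [x]) * (a + c - llSum p q (l ++ [x])) else 0)
        ≤ ∑ x, (seqProb str l * ((a + c - llSum p q l) * str l x)
          - seqProb str l * (str l x * Real.log (p x / q x))) := by
      refine Finset.sum_le_sum fun x _ => ?_
      have e : seqProb str (l ++ [x]) * (a + c - llSum p q (l ++ [x]))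
          = seqProb str l * ((a + c - llSum p q l) * str l x)
            - seqProb str l * (str l x * Real.log (p x / q x)) := by
        rw [seqProb_append_singleton, llSum_append_singleton]
        ring
      rw [← e]
      split_ifs
      · exact le_rfl
      · have h1 := hB l hl.not_self
        have h2 := (le_abs_self _).trans (hc x)
        refine mul_nonneg (seqProb_nonneg (fun l => (hstr l).1) _) ?_
        rw [llSum_append_singleton]
        linarith
    rw [Finset.sum_sub_distrib, ← Finset.mul_sum, ← Finset.mul_sum, ← Finset.mul_sum,
      (hstr l).2, mul_one] at hle
    have := mul_le_mul_of_nonneg_left (hdrift l) hs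
    simp only [hl, if_true]
    linarith
  · have h0 : ∀ x, ¬ notYet B (l ++ [x]) := fun x h => hl h.of_append_singleton
    simp [hl, h0]

/-- Drift bound on the expected hitting time of a region containing `{S ≥ a}`. -/
theorem expTau_le_of_drift (hstr : ∀ l, IsDist (str l)) (ha : 0 ≤ a) (hc0 : 0 ≤ c)
    (hc : ∀ x, |Real.log (p x / q x)| ≤ c) (hD : 0 < D)
    (hdrift : ∀ l, D ≤ ∑ x, str l x * Real.log (p x / q x))
    (hB : ∀ l, ¬ B l → llSum p q l < a) :
    expTau str B ≤ ENNReal.ofReal ((a + c) / D) := by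
  have hprob : ∀ n, 0 ≤ probAt str n (notYet B) := fun n => Finset.sum_nonneg fun y _ => by
    split_ifs
    · exact seqProb_nonneg (fun l => (hstr l).1) _
    · exact le_rfl
  have hzero : expGap str B p q (a + c) 0 ≤ a + c := by
    simp only [expGap, Finset.univ_unique, List.ofFn_zero, Finset.sum_singleton]
    split_ifs
    · simp [seqProb, llSum]
    · positivity
  have hsum : ∀ N, D * ∑ n ∈ Finset.range N, probAt str n (notYet B)
      + expGap str B p q (a + c) N ≤ a + c := by
    intro N
    induction N with
    | zero => simpa using hzero
    | succ N ih =>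
      have := expGap_succ_le hstr hc hdrift hB N
      rw [Finset.sum_range_succ, mul_add]
      linarith
  refine ENNReal.tsum_le_of_sum_range_le fun N => ?_
  rw [← ENNReal.ofReal_sum_of_nonneg fun n _ => hprob n]
  refine ENNReal.ofReal_le_ofReal ?_
  rw [le_div_iff₀' hD]
  linarith [hsum N, expGap_nonneg hstr hc0 hB N]

end drift

/-- Expected stopping time bound against one adaptive adversary, with respect to the minimising
pair of the divergence. -/
theorem expTau_le_of_isMin_KL [Fintype 𝒳] [Nonempty 𝒳] {P Q : Set (𝒳 → ℝ)}
    (hP : ∀ p ∈ P, IsDist p) (hQ : ∀ q ∈ Q, IsDist q) (hPconv : Convex ℝ P)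
    (hdisj : Disjoint P Q) (hac : ∀ p ∈ P, ∀ q ∈ Q, ∀ x, (p x = 0 ↔ q x = 0))
    {p₀ q₀ : 𝒳 → ℝ} (hp₀ : p₀ ∈ P) (hq₀ : q₀ ∈ Q)
    (hmin : ∀ p ∈ P, ∀ q ∈ Q, KL p₀ q₀ ≤ KL p q)
    {str : List 𝒳 → 𝒳 → ℝ} (hstr : IsStrategy P str) {a : ℝ} (ha : 0 ≤ a)
    {B : List 𝒳 → Prop} (hB : ∀ l, ¬ B l → llSum p₀ q₀ l < a) :
    expTau str B ≤ ENNReal.ofReal ((a + ⨆ x, |Real.log (p₀ x / q₀ x)|) / KL p₀ q₀) :=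
  expTau_le_of_drift (fun l => hP _ (hstr l)) ha (Real.iSup_nonneg fun _ => abs_nonneg _)
    (fun x => le_ciSup (f := fun x => |Real.log (p₀ x / q₀ x)|) (Set.finite_range _).bddAbove x)
    (KL_pos (hP p₀ hp₀) (hQ q₀ hq₀) (hac p₀ hp₀ q₀ hq₀) (hdisj.ne_of_mem hp₀ hq₀))
    (fun l => KL_le_sum_mul_log_of_isMin hP hPconv hp₀ (fun p hp => hac p hp q₀ hq₀)
      (fun p hp => hmin p hp q₀ hq₀) (hstr l)) hB

/-- Fix `α₀, α₁ > 0`, `n`, and let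
`τ_n = inf{t : S_{0,t} ≥ α₀n or S_{1,t} ≥ α₁n}`, `c₀ = max_x |log(p₀*(x)/q₀*(x))|`,
`c₁ = max_x |log(q₁*(x)/p₁*(x))|`.  Then under every adaptive adversary strategy for `H₀`
(law `ℙ`), `E_ℙ[τ_n] ≤ (α₀n + c₀)/D(p₀*‖q₀*)`, and under every adaptive adversary strategy
for `H₁` (law `ℚ`), `E_ℚ[τ_n] ≤ (α₁n + c₁)/D(q₁*‖p₁*)`. -/
theorem stmt11 [Fintype 𝒳] [Nonempty 𝒳]
    (P Q : Set (𝒳 → ℝ))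
    (hP : ∀ p ∈ P, IsDist p) (hQ : ∀ q ∈ Q, IsDist q)
    (hPclosed : IsClosed P) (hQclosed : IsClosed Q)
    (hPconv : Convex ℝ P) (hQconv : Convex ℝ Q)
    (hdisj : Disjoint P Q)
    (hac : ∀ p ∈ P, ∀ q ∈ Q, ∀ x, (p x = 0 ↔ q x = 0))
    (p₀ q₀ : 𝒳 → ℝ) (hp₀ : p₀ ∈ P) (hq₀ : q₀ ∈ Q)
    (hmin₀ : ∀ p ∈ P, ∀ q ∈ Q, KL p₀ q₀ ≤ KL p q)
    (p₁ q₁ : 𝒳 → ℝ) (hp₁ : p₁ ∈ P) (hq₁ : q₁ ∈ Q)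
    (hmin₁ : ∀ p ∈ P, ∀ q ∈ Q, KL q₁ p₁ ≤ KL q p)
    (strP strQ : List 𝒳 → 𝒳 → ℝ)
    (hstrP : IsStrategy P strP) (hstrQ : IsStrategy Q strQ)
    (c₀ c₁ : ℝ) (hc₀ : c₀ = ⨆ x, |Real.log (p₀ x / q₀ x)|)
    (hc₁ : c₁ = ⨆ x, |Real.log (q₁ x / p₁ x)|)
    (α₀ α₁ : ℝ) (hα₀ : 0 < α₀) (hα₁ : 0 < α₁) (n : ℕ) :
    expTau strP (fun l => α₀ * n ≤ llSum p₀ q₀ l ∨ α₁ * n ≤ llSum q₁ p₁ l) ≤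
      ENNReal.ofReal ((α₀ * n + c₀) / KL p₀ q₀) ∧
    expTau strQ (fun l => α₀ * n ≤ llSum p₀ q₀ l ∨ α₁ * n ≤ llSum q₁ p₁ l) ≤
      ENNReal.ofReal ((α₁ * n + c₁) / KL q₁ p₁) := by
  subst hc₀ hc₁
  refine ⟨expTau_le_of_isMin_KL hP hQ hPconv hdisj hac hp₀ hq₀ hmin₀ hstrP (by positivity) ?_,
    expTau_le_of_isMin_KL hQ hP hQconv hdisj.symm (fun q hq p hp x => (hac p hp q hq x).symm)
      hq₁ hp₁ (fun q hq p hp => hmin₁ p hp q hq) hstrQ (by positivity) ?_⟩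
  · exact fun l hl => not_le.1 fun h => hl (Or.inl h)
  · exact fun l hl => not_le.1 fun h => hl (Or.inr h)
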